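/- arXiv:2101.02095 — 5 statements merged into one kernel-verified Lean document; each statement's English description precedes it below -/
import Mathlib

section
/- Let G = (V,E) be a finite simple connected graph that is not complete. Then sc(G) = max over all minimal separators S of G of [ Σ_{i=1}^{k} max{ sc(G[C_i]), 1 } − |S| ], where C_1, …, C_k are the connected components of the subgraph induced by V∖S and G[C_i] denotes the subgraph induced by C_i. -/
open SimpleGraph

variable {V : Type*}

noncomputable def numComp (G : SimpleGraph V) (S : Set V) : ℕ :=
  Nat.card (G.induce Sᶜ).ConnectedComponent

def SeparatedBy (G : SimpleGraph V) (S : Set V) (u v : V) : Prop :=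
  ∃ (hu : u ∈ Sᶜ) (hv : v ∈ Sᶜ), ¬ (G.induce Sᶜ).Reachable ⟨u, hu⟩ ⟨v, hv⟩

def IsSeparator (G : SimpleGraph V) (S : Set V) : Prop :=
  ∃ u v, G.Reachable u v ∧ SeparatedBy G S u v

def IsMinimalSeparator (G : SimpleGraph V) (S : Set V) : Prop :=
  IsSeparator G S ∧ ∀ T ⊂ S, ¬ IsSeparator G T

def IsMVS (G : SimpleGraph V) (S : Set V) : Prop :=
  ∃ u v, u ≠ v ∧ ¬ G.Adj u v ∧ SeparatedBy G S u v ∧ ∀ T ⊂ S, ¬ SeparatedBy G T u v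

def IsChordal (G : SimpleGraph V) : Prop :=
  ∀ n, 4 ≤ n → IsEmpty (cycleGraph n ↪g G)

def StrictlyChordal (G : SimpleGraph V) : Prop :=
  G.Connected ∧ IsChordal G ∧
    ∀ S S' : Set V, IsMVS G S → IsMVS G S' → S ≠ S' → Disjoint S S'

noncomputable def sc [Finite V] (G : SimpleGraph V) : ℤ :=
  sSup {k : ℤ | ∃ S : Set V, numComp G S ≠ 1 ∧ k = (numComp G S : ℤ) - (Nat.card S : ℤ)}

noncomputable def toughness [Finite V] (G : SimpleGraph V) : ℝ :=
  sInf {t : ℝ | ∃ S : Set V, 1 < numComp G S ∧ t = (Nat.card S : ℝ) / (numComp G S : ℝ)}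

def IsScatteringSet [Finite V] (G : SimpleGraph V) (S : Set V) : Prop :=
  numComp G S ≠ 1 ∧ (numComp G S : ℤ) - (Nat.card S : ℤ) = sc G

def IsMaxClique (G : SimpleGraph V) (Q : Set V) : Prop :=
  G.IsClique Q ∧ ∀ R : Set V, G.IsClique R → Q ⊆ R → Q = R

def IsSimplicial (G : SimpleGraph V) (v : V) : Prop :=
  G.IsClique (G.neighborSet v)

def IsBoundaryClique (G : SimpleGraph V) (Q : Set V) : Prop :=
  IsMaxClique G Q ∧ (∃ v ∈ Q, IsSimplicial G v) ∧
    ∃ Q' : Set V, IsMaxClique G Q' ∧ Q' ≠ Q ∧ Q ∩ Q' = {v | v ∈ Q ∧ ¬ IsSimplicial G v}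

def BS (G : SimpleGraph V) (S : Set V) : Set (Set V) :=
  {Q | IsBoundaryClique G Q ∧ S ⊆ Q}

theorem numComp_univ (G : SimpleGraph V) : numComp G Set.univ = 0 := by
  have : IsEmpty ((Set.univ : Set V)ᶜ : Set V) := by simp
  have : IsEmpty (G.induce (Set.univ : Set V)ᶜ).ConnectedComponent :=
    ⟨fun c => c.ind fun v => isEmptyElim v⟩
  simp [numComp]

theorem numComp_ne_zero_of_ne_univ [Finite V] (G : SimpleGraph V) {S : Set V}
    (hS : S ≠ Set.univ) : numComp G S ≠ 0 := by
  obtain ⟨v, hv⟩ := (Set.ne_univ_iff_exists_notMem S).1 hS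
  have : Nonempty (G.induce Sᶜ).ConnectedComponent :=
    ⟨(G.induce Sᶜ).connectedComponentMk ⟨v, hv⟩⟩
  exact Nat.card_pos.ne'

theorem one_lt_numComp_iff [Finite V] (G : SimpleGraph V) (S : Set V) :
    1 < numComp G S ↔ ∃ u v, SeparatedBy G S u v := by
  rw [numComp, Finite.one_lt_card_iff_nontrivial, nontrivial_iff]
  constructor
  · rintro ⟨c, d, hcd⟩
    induction c using ConnectedComponent.ind with | _ u
    induction d using ConnectedComponent.ind with | _ v
    exact ⟨u, v, u.2, v.2, fun h => hcd (ConnectedComponent.sound h)⟩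
  · rintro ⟨u, v, hu, hv, h⟩
    exact ⟨_, _, fun e => h (ConnectedComponent.exact e)⟩

theorem isSeparator_iff_one_lt_numComp [Finite V] {G : SimpleGraph V} (hG : G.Connected)
    (S : Set V) : IsSeparator G S ↔ 1 < numComp G S := by
  simp [one_lt_numComp_iff, IsSeparator, hG.preconnected _ _]

theorem IsSeparator.exists_isMinimalSeparator_subset [Finite V] {G : SimpleGraph V} {S : Set V}
    (hS : IsSeparator G S) : ∃ T ⊆ S, IsMinimalSeparator G T := by
  obtain ⟨T, hTS, hT⟩ := (Set.toFinite {T | IsSeparator G T}).exists_le_minimal hS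
  exact ⟨T, hTS, hT.prop, fun R hR hsep => hT.not_lt hsep hR⟩

theorem bddAbove_numComp_sub_card [Finite V] (G : SimpleGraph V) :
    BddAbove {k : ℤ | ∃ S : Set V, numComp G S ≠ 1 ∧
      k = (numComp G S : ℤ) - (Nat.card S : ℤ)} := by
  refine ((Set.finite_range
    fun S : Set V => (numComp G S : ℤ) - (Nat.card S : ℤ)).subset ?_).bddAbove
  rintro _ ⟨S, -, rfl⟩
  exact ⟨S, rfl⟩

theorem numComp_sub_card_le_sc [Finite V] (G : SimpleGraph V) {S : Set V}
    (hS : numComp G S ≠ 1) : (numComp G S : ℤ) - (Nat.card S : ℤ) ≤ sc G :=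
  le_csSup (bddAbove_numComp_sub_card G) ⟨S, hS, rfl⟩

theorem exists_isScatteringSet [Finite V] (G : SimpleGraph V) : ∃ S, IsScatteringSet G S := by
  have hne : {k : ℤ | ∃ S : Set V, numComp G S ≠ 1 ∧
      k = (numComp G S : ℤ) - (Nat.card S : ℤ)}.Nonempty :=
    ⟨_, Set.univ, by simp [numComp_univ], rfl⟩
  obtain ⟨S, hS, h⟩ := Int.csSup_mem hne (bddAbove_numComp_sub_card G)
  exact ⟨S, hS, h.symm⟩

theorem numComp_sub_card_le_max [Finite V] (G : SimpleGraph V) (S : Set V) :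
    (numComp G S : ℤ) - (Nat.card S : ℤ) ≤ max (sc G) 1 := by
  by_cases h : numComp G S = 1
  · exact le_max_of_le_right (by simp [h])
  · exact le_max_of_le_left (numComp_sub_card_le_sc G h)

theorem SimpleGraph.Connected.numComp_empty {G : SimpleGraph V} (hG : G.Connected) :
    numComp G ∅ = 1 := by
  have hc : (G.induce (∅ : Set V)ᶜ).Connected :=
    hG.map ⟨fun v => ⟨v, Set.notMem_empty v⟩, id⟩ fun v => ⟨v, rfl⟩
  have := hc.nonempty
  exact Nat.card_eq_one_iff_unique.2 ⟨hc.preconnected.subsingleton_connectedComponent,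
    ⟨(G.induce _).connectedComponentMk (Classical.arbitrary _)⟩⟩

theorem SimpleGraph.Connected.exists_numComp_sub_card_eq_max [Finite V] {G : SimpleGraph V}
    (hG : G.Connected) :
    ∃ S : Set V, (numComp G S : ℤ) - (Nat.card S : ℤ) = max (sc G) 1 := by
  obtain h | h := le_total (sc G) 1
  · exact ⟨∅, by simp [hG.numComp_empty, h]⟩
  · obtain ⟨S, -, hS⟩ := exists_isScatteringSet G
    exact ⟨S, by rw [hS, max_eq_left h]⟩

theorem connected_induce_val_image_supp (G : SimpleGraph V) {S : Set V}
    (c : (G.induce S).ConnectedComponent) :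
    (G.induce (Subtype.val '' c.supp)).Connected := by
  refine c.connected_toSimpleGraph.map
    ⟨fun v => ⟨v.1.1, v.1, v.2, rfl⟩, id⟩ ?_
  rintro ⟨_, v, hv, rfl⟩
  exact ⟨⟨v, hv⟩, rfl⟩

/-- The inclusion of `G[C] - (S ∩ C)` into `G - S`. -/
def induceInduceHom (G : SimpleGraph V) (C S : Set V) :
    (G.induce C).induce (Subtype.val ⁻¹' S : Set C)ᶜ →g G.induce Sᶜ :=
  ⟨fun v => ⟨v.1.1, v.2⟩, id⟩

theorem reachable_induce_of_walk (G : SimpleGraph V) {S T : Set V} (hTS : T ⊆ S)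
    (c : (G.induce Tᶜ).ConnectedComponent) {a b : (Sᶜ : Set V)}
    (p : (G.induce Sᶜ).Walk a b) (ha : a.1 ∈ Subtype.val '' c.supp) :
    ∃ hb : b.1 ∈ Subtype.val '' c.supp,
      ((G.induce (Subtype.val '' c.supp)).induce (Subtype.val ⁻¹' S)ᶜ).Reachable
        ⟨⟨a.1, ha⟩, a.2⟩ ⟨⟨b.1, hb⟩, b.2⟩ := by
  induction p with
  | nil => exact ⟨ha, Reachable.rfl⟩
  | @cons u v w huv p ih =>
    have hv : v.1 ∈ Subtype.val '' c.supp := by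
      obtain ⟨x, hx, hxu⟩ := ha
      refine ⟨⟨v.1, fun h => v.2 (hTS h)⟩, ?_, rfl⟩
      refine (c.mem_supp_congr_adj (v := x) ?_).1 hx
      change G.Adj x.1 v.1
      rw [hxu]
      exact huv
    obtain ⟨hw, h⟩ := ih hv
    refine ⟨hw, Reachable.trans (Adj.reachable ?_) h⟩
    exact huv

theorem eq_of_mem_val_image_supp {G : SimpleGraph V} {S : Set V}
    {c d : (G.induce S).ConnectedComponent} {v : V} (hc : v ∈ Subtype.val '' c.supp)
    (hd : v ∈ Subtype.val '' d.supp) : c = d := by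
  obtain ⟨x, hx, rfl⟩ := hc
  obtain ⟨y, hy, hxy⟩ := hd
  rw [Subtype.ext hxy] at hy
  exact ConnectedComponent.eq_of_common_vertex hx hy

theorem mem_val_image_supp_mk (G : SimpleGraph V) {S : Set V} {v : V} (hv : v ∈ S) :
    v ∈ Subtype.val '' ((G.induce S).connectedComponentMk ⟨v, hv⟩).supp :=
  ⟨⟨v, hv⟩, rfl, rfl⟩

theorem numComp_eq_sum [Finite V] (G : SimpleGraph V) {S T : Set V} (hTS : T ⊆ S)
    [Fintype (G.induce Tᶜ).ConnectedComponent] :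
    numComp G S = ∑ c : (G.induce Tᶜ).ConnectedComponent,
      numComp (G.induce (Subtype.val '' c.supp)) (Subtype.val ⁻¹' S) := by
  unfold numComp
  rw [← Nat.card_sigma]
  refine (Nat.card_eq_of_bijective
    (fun x => x.2.map (induceInduceHom G (Subtype.val '' x.1.supp) S)) ⟨?_, ?_⟩).symm
  · rintro ⟨c, a⟩ ⟨d, b⟩ h
    induction a using ConnectedComponent.ind with | _ a
    induction b using ConnectedComponent.ind with | _ b
    obtain ⟨p⟩ := ConnectedComponent.exact h
    obtain ⟨hb, hab⟩ := reachable_induce_of_walk G hTS c p a.1.2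
    obtain rfl := eq_of_mem_val_image_supp hb b.1.2
    exact congrArg _ (ConnectedComponent.sound hab)
  · intro a
    induction a using ConnectedComponent.ind with | _ a
    have ha : a.1 ∈ Tᶜ := fun h => a.2 (hTS h)
    exact ⟨⟨_, connectedComponentMk _ ⟨⟨a.1, mem_val_image_supp_mk G ha⟩, a.2⟩⟩, rfl⟩

theorem card_eq_sum_add_card [Finite V] (G : SimpleGraph V) {S T : Set V} (hTS : T ⊆ S)
    [Fintype (G.induce Tᶜ).ConnectedComponent] :
    Nat.card S = ∑ c : (G.induce Tᶜ).ConnectedComponent,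
      Nat.card (Subtype.val ⁻¹' S : Set (Subtype.val '' c.supp : Set V)) + Nat.card T := by
  rw [← Nat.card_sigma, ← Nat.card_sum]
  refine (Nat.card_eq_of_bijective
    (Sum.elim (fun x => (⟨x.2.1.1, x.2.2⟩ : S)) (fun t => ⟨t.1, hTS t.2⟩)) ⟨?_, ?_⟩).symm
  · refine Function.Injective.sumElim ?_ ?_ ?_
    · rintro ⟨c, ⟨x, hx⟩, hxS⟩ ⟨d, ⟨y, hy⟩, hyS⟩ h
      obtain rfl : x = y := congrArg Subtype.val h
      obtain rfl := eq_of_mem_val_image_supp hx hy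
      rfl
    · intro x y h
      exact Subtype.ext (congrArg (fun s : S => s.1) h)
    · rintro ⟨c, ⟨x, z, hz, rfl⟩, hxS⟩ t h
      have : z.1 = t.1 := congrArg Subtype.val h
      exact z.2 (this ▸ t.2)
  · rintro ⟨v, hv⟩
    by_cases hT : v ∈ T
    · exact ⟨Sum.inr ⟨v, hT⟩, rfl⟩
    · exact ⟨Sum.inl ⟨_, ⟨v, mem_val_image_supp_mk G hT⟩, hv⟩, rfl⟩

theorem numComp_sub_card_eq_sum [Finite V] (G : SimpleGraph V) {S T : Set V} (hTS : T ⊆ S)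
    [Fintype (G.induce Tᶜ).ConnectedComponent] :
    (numComp G S : ℤ) - (Nat.card S : ℤ) = ∑ c : (G.induce Tᶜ).ConnectedComponent,
      ((numComp (G.induce (Subtype.val '' c.supp)) (Subtype.val ⁻¹' S) : ℤ) -
        (Nat.card (Subtype.val ⁻¹' S : Set (Subtype.val '' c.supp : Set V)) : ℤ)) -
      (Nat.card T : ℤ) := by
  rw [numComp_eq_sum G hTS, card_eq_sum_add_card G hTS, Finset.sum_sub_distrib]
  push_cast
  ring

theorem exists_superset_preimage_eq (G : SimpleGraph V) (T : Set V)
    (R : ∀ c : (G.induce Tᶜ).ConnectedComponent, Set (Subtype.val '' c.supp : Set V)) :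
    ∃ S, T ⊆ S ∧ ∀ c, Subtype.val ⁻¹' S = R c := by
  refine ⟨T ∪ ⋃ c, Subtype.val '' R c, Set.subset_union_left, fun c => ?_⟩
  ext x
  simp only [Set.mem_preimage, Set.mem_union, Set.mem_iUnion]
  constructor
  · rintro (h | ⟨d, y, hy, hyx⟩)
    · obtain ⟨z, -, hz⟩ := x.2
      exact absurd (hz ▸ h) z.2
    · obtain rfl : d = c := eq_of_mem_val_image_supp y.2 (hyx ▸ x.2)
      rwa [← Subtype.ext hyx]
  · exact fun h => Or.inr ⟨c, x, h, rfl⟩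

theorem numComp_sub_card_le_sum_max [Finite V] (G : SimpleGraph V) {S T : Set V} (hTS : T ⊆ S)
    [Fintype (G.induce Tᶜ).ConnectedComponent] :
    (numComp G S : ℤ) - (Nat.card S : ℤ) ≤ ∑ c : (G.induce Tᶜ).ConnectedComponent,
      max (sc (G.induce (Subtype.val '' c.supp))) 1 - (Nat.card T : ℤ) := by
  rw [numComp_sub_card_eq_sum G hTS]
  exact sub_le_sub_right (Finset.sum_le_sum fun c _ => numComp_sub_card_le_max _ _) _

theorem sum_max_sub_card_le_sc [Finite V] (G : SimpleGraph V) {T : Set V}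
    (hT : 1 < numComp G T) [Fintype (G.induce Tᶜ).ConnectedComponent] :
    ∑ c : (G.induce Tᶜ).ConnectedComponent,
      max (sc (G.induce (Subtype.val '' c.supp))) 1 - (Nat.card T : ℤ) ≤ sc G := by
  choose R hR using fun c : (G.induce Tᶜ).ConnectedComponent =>
    (connected_induce_val_image_supp G c).exists_numComp_sub_card_eq_max
  obtain ⟨S, hTS, hS⟩ := exists_superset_preimage_eq G T R
  have hsum := numComp_sub_card_eq_sum G hTS
  simp only [hS, hR] at hsum
  rw [← hsum]
  refine numComp_sub_card_le_sc G (ne_of_gt (hT.trans_le ?_))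
  rw [numComp_eq_sum G hTS, numComp, Nat.card_eq_fintype_card, Fintype.card_eq_sum_ones]
  refine Finset.sum_le_sum fun c _ => ?_
  have h := (le_max_right _ _).trans_eq (hR c).symm
  rw [hS]
  omega

theorem IsScatteringSet.one_lt_numComp [Finite V] {G : SimpleGraph V} (hG : G ≠ ⊤) {S : Set V}
    (hS : IsScatteringSet G S) : 1 < numComp G S := by
  obtain ⟨u, v, huv, hadj⟩ := ne_top_iff_exists_not_adj.1 hG
  have hpair : 1 < numComp G ({u, v}ᶜ : Set V) := by
    refine (one_lt_numComp_iff _ _).2 ⟨u, v, by simp, by simp, fun h => ?_⟩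
    have hbot : G.induce ({u, v}ᶜ : Set V)ᶜ = ⊥ := by
      ext ⟨x, hx⟩ ⟨y, hy⟩
      simp only [compl_compl, Set.mem_insert_iff, Set.mem_singleton_iff] at hx hy
      rcases hx with rfl | rfl <;> rcases hy with rfl | rfl <;> simp [hadj, mt Adj.symm hadj]
    rw [hbot, reachable_bot] at h
    exact huv (congrArg Subtype.val h)
  have hle := numComp_sub_card_le_sc G hpair.ne'
  have hcard : Nat.card ({u, v}ᶜ : Set V) ≤ Nat.card (Set.univ : Set V) :=
    Nat.card_mono (Set.toFinite _) (Set.subset_univ _)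
  by_contra h
  have h0 : numComp G S = 0 := by have := hS.1; omega
  obtain rfl : S = Set.univ := by
    by_contra hne
    exact numComp_ne_zero_of_ne_univ G hne h0
  have := hS.2
  omega

theorem statement1 {V : Type*} [Finite V] (G : SimpleGraph V)
    (hconn : G.Connected) (hnc : G ≠ ⊤) :
    IsGreatest {k : ℤ | ∃ S : Set V, IsMinimalSeparator G S ∧
        k = (∑ᶠ c : (G.induce Sᶜ).ConnectedComponent,
              max (sc (G.induce (Subtype.val '' c.supp))) 1) - (Nat.card S : ℤ)}
      (sc G) := by
  have hupper : ∀ T, IsMinimalSeparator G T →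
      (∑ᶠ c : (G.induce Tᶜ).ConnectedComponent,
        max (sc (G.induce (Subtype.val '' c.supp))) 1) - (Nat.card T : ℤ) ≤ sc G := by
    intro T hT
    have := Fintype.ofFinite (G.induce Tᶜ).ConnectedComponent
    rw [finsum_eq_sum_of_fintype]
    exact sum_max_sub_card_le_sc G ((isSeparator_iff_one_lt_numComp hconn T).1 hT.1)
  refine ⟨?_, ?_⟩
  · obtain ⟨S, hS⟩ := exists_isScatteringSet G
    obtain ⟨T, hTS, hT⟩ := ((isSeparator_iff_one_lt_numComp hconn S).2
      (hS.one_lt_numComp hnc)).exists_isMinimalSeparator_subset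
    refine ⟨T, hT, le_antisymm ?_ (hupper T hT)⟩
    have := Fintype.ofFinite (G.induce Tᶜ).ConnectedComponent
    rw [finsum_eq_sum_of_fintype, ← hS.2]
    exact numComp_sub_card_le_sum_max G hTS
  · rintro _ ⟨T, hT, rfl⟩
    exact hupper T hT
end

section
/- Let G be a finite simple connected chordal graph. Then any two distinct minimal vertex separators of G are disjoint if and only if G contains no induced gem and no induced dart. -/
open SimpleGraph

variable {V : Type*}

def gem : SimpleGraph (Fin 5) :=
  SimpleGraph.fromRel (fun a b =>
    (a = 0 ∧ b = 1) ∨ (a = 1 ∧ b = 2) ∨ (a = 2 ∧ b = 3) ∨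
    (a = 4 ∧ (b = 0 ∨ b = 1 ∨ b = 2 ∨ b = 3)))

def dart : SimpleGraph (Fin 5) :=
  SimpleGraph.fromRel (fun a b =>
    (a = 0 ∧ (b = 1 ∨ b = 2)) ∨ (a = 1 ∧ (b = 2 ∨ b = 3)) ∨ (a = 2 ∧ b = 3) ∨ (a = 4 ∧ b = 1))

section Separators

variable {G : SimpleGraph V} {S T : Set V} {u v w x y : V}

lemma SeparatedBy.symm (h : SeparatedBy G S u v) : SeparatedBy G S v u :=
  let ⟨hu, hv, hr⟩ := h
  ⟨hv, hu, fun h' => hr h'.symm⟩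

lemma SeparatedBy.mem_of_adj_of_adj (h : SeparatedBy G S u v) (hu : G.Adj u w)
    (hv : G.Adj w v) : w ∈ S := by
  obtain ⟨hu', hv', hr⟩ := h
  by_contra hw
  have h₁ : (G.induce Sᶜ).Adj ⟨u, hu'⟩ ⟨w, hw⟩ := hu
  have h₂ : (G.induce Sᶜ).Adj ⟨w, hw⟩ ⟨v, hv'⟩ := hv
  exact hr (h₁.reachable.trans h₂.reachable)

lemma separatedBy_compl_pair (hne : u ≠ v) (huv : ¬ G.Adj u v) :
    SeparatedBy G ({u, v}ᶜ : Set V) u v := by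
  refine ⟨by simp, by simp, fun ⟨p⟩ => ?_⟩
  cases p with
  | nil => exact hne rfl
  | @cons _ b _ h q =>
    have h' : G.Adj u b := h
    have hb : (b : V) = u ∨ (b : V) = v := by simpa using b.2
    rcases hb with hb | hb
    · exact h'.ne hb.symm
    · exact huv (hb ▸ h')

/-- Two distinct non-adjacent vertices of a finite graph have a minimal separator. -/
lemma exists_minimal_separatedBy [Finite V] (hne : u ≠ v) (huv : ¬ G.Adj u v) :
    ∃ S, SeparatedBy G S u v ∧ IsMVS G S := by
  obtain ⟨S, hS⟩ := (Set.toFinite {S : Set V | SeparatedBy G S u v}).exists_minimal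
    ⟨_, separatedBy_compl_pair hne huv⟩
  exact ⟨S, hS.prop, u, v, hne, huv, hS.prop, fun T hT h => hT.not_subset (hS.le_of_le h hT.subset)⟩

/-- The vertices outside `S` that are reachable from `u` in `G - S`. -/
def componentAvoiding (G : SimpleGraph V) (S : Set V) (u : V) : Set V :=
  {w | ∃ (hu : u ∈ Sᶜ) (hw : w ∈ Sᶜ), (G.induce Sᶜ).Reachable ⟨u, hu⟩ ⟨w, hw⟩}

lemma not_mem_of_mem_componentAvoiding (h : w ∈ componentAvoiding G S u) : w ∉ S :=
  h.2.1

lemma mem_componentAvoiding_of_adj (h : w ∈ componentAvoiding G S u) (hwx : G.Adj w x)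
    (hx : x ∉ S) : x ∈ componentAvoiding G S u := by
  obtain ⟨hu, hw, hr⟩ := h
  have hadj : (G.induce Sᶜ).Adj ⟨w, hw⟩ ⟨x, hx⟩ := hwx
  exact ⟨hu, hx, hr.trans hadj.reachable⟩

lemma SeparatedBy.disjoint_componentAvoiding (h : SeparatedBy G S u v) :
    Disjoint (componentAvoiding G S u) (componentAvoiding G S v) := by
  rw [Set.disjoint_left]
  rintro w ⟨hu, hw, h₁⟩ ⟨hv, _, h₂⟩
  exact h.2.2 (h₁.trans h₂.symm)

lemma exists_adj_mem_componentAvoiding (h : SeparatedBy G S u v)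
    (hmin : ∀ T ⊂ S, ¬ SeparatedBy G T u v) (hx : x ∈ S) :
    ∃ a ∈ componentAvoiding G S u, G.Adj x a := by
  by_contra! hno
  refine hmin (S \ {x}) (Set.sdiff_singleton_ssubset.2 hx) ?_
  obtain ⟨hu, hv, hr⟩ := h
  have hle : S \ {x} ⊆ S := Set.sdiff_subset
  refine ⟨fun h => hu (hle h), fun h => hv (hle h), fun ⟨p⟩ => ?_⟩
  have key : ∀ (a b : ((S \ {x})ᶜ : Set V)), (G.induce (S \ {x})ᶜ).Walk a b →
      (a : V) ∈ componentAvoiding G S u → (b : V) ∈ componentAvoiding G S u := by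
    intro a b p
    induction p with
    | nil => exact id
    | @cons a b c hab _ ih =>
      intro ha
      have hab' : G.Adj a b := hab
      refine ih (mem_componentAvoiding_of_adj ha hab' fun hb => b.2 ⟨hb, ?_⟩)
      intro hbx
      rw [Set.mem_singleton_iff.1 hbx] at hab'
      exact hno _ ha hab'.symm
  obtain ⟨_, _, h'⟩ := key _ _ p ⟨hu, hu, .refl _⟩
  exact hr h'

/-- `f` traces a walk of length `k ≥ 2` from `x` to `y` with interior in `A`. -/
def IsTraceThrough (G : SimpleGraph V) (A : Set V) (x y : V) (k : ℕ) (f : ℕ → V) : Prop :=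
  2 ≤ k ∧ f 0 = x ∧ f k = y ∧ (∀ i, 0 < i → i < k → f i ∈ A) ∧ ∀ i < k, G.Adj (f i) (f (i + 1))

lemma exists_isTraceThrough {a b : V} (ha : a ∈ componentAvoiding G S u)
    (hb : b ∈ componentAvoiding G S u) (hxa : G.Adj x a) (hyb : G.Adj y b) :
    ∃ k f, IsTraceThrough G (componentAvoiding G S u) x y k f := by
  obtain ⟨hu, ha', hra⟩ := ha
  obtain ⟨_, hb', hrb⟩ := hb
  obtain ⟨p⟩ := hra.symm.trans hrb
  refine ⟨p.length + 2, fun i => if i = 0 then x else if i ≤ p.length + 1 then p.getVert (i - 1)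
    else y, by lia, by simp, by simp, ?_, ?_⟩
  · intro i h₀ h₁
    beta_reduce
    rw [if_neg (by lia), if_pos (by lia)]
    exact ⟨hu, Subtype.prop _, hra.trans (p.take (i - 1)).reachable⟩
  · intro i hi
    rcases Nat.eq_zero_or_pos i with rfl | h₀
    · simpa using hxa
    · beta_reduce
      rw [if_neg (by lia), if_pos (by lia), if_neg (by lia)]
      split_ifs with h
      · have hadj := p.adj_getVert_succ (i := i - 1) (by lia)
        rw [show i - 1 + 1 = i + 1 - 1 by lia] at hadj
        exact hadj
      · have : i - 1 = p.length := by lia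
        rw [this, p.getVert_length]
        exact hyb.symm

/-- A shortest walk through `A` is an induced path, except possibly for an edge joining its ends. -/
lemma IsTraceThrough.exists_induced {A : Set V} (hxy : x ≠ y) (hx : x ∉ A) (hy : y ∉ A)
    (h : ∃ k f, IsTraceThrough G A x y k f) :
    ∃ k f, IsTraceThrough G A x y k f ∧ ∀ i j, i < j → j ≤ k →
      f i ≠ f j ∧ (G.Adj (f i) (f j) → j = i + 1 ∨ (i = 0 ∧ j = k)) := by
  classical
  obtain ⟨f, hf⟩ := Nat.find_spec h
  have hmin : ∀ m g, IsTraceThrough G A x y m g → Nat.find h ≤ m :=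
    fun m g hg => Nat.find_min' h ⟨g, hg⟩
  refine ⟨Nat.find h, f, hf, ?_⟩
  generalize Nat.find h = k at hf hmin
  obtain ⟨hk, h0, hkk, hA, hadj⟩ := hf
  intro i j hij hjk
  constructor
  · intro heq
    have hi : 0 < i := by
      by_contra hi
      obtain rfl : i = 0 := by lia
      rcases hjk.eq_or_lt with rfl | hjk
      · exact hxy (h0 ▸ hkk ▸ heq)
      · exact hx (h0 ▸ heq ▸ hA j hij hjk)
    have hj : j < k := by
      refine lt_of_le_of_ne hjk ?_
      rintro rfl
      exact hy (hkk ▸ heq ▸ hA i hi hij)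
    have := hmin (k - (j - i)) (fun m => if m ≤ i then f m else f (m + (j - i))) ?_
    · lia
    refine ⟨by lia, by simp [h0], ?_, ?_, ?_⟩
    · beta_reduce
      rw [if_neg (by lia), ← hkk]; congr 1; lia
    · intro m h₀ h₁
      beta_reduce
      split_ifs
      · exact hA m h₀ (by lia)
      · exact hA _ (by lia) (by lia)
    · intro m hm
      beta_reduce
      rcases lt_trichotomy m i with hmi | rfl | hmi
      · rw [if_pos (by lia), if_pos (by lia)]; exact hadj m (by lia)
      · rw [if_pos le_rfl, if_neg (by lia), heq]
        rw [show m + 1 + (j - m) = j + 1 by lia]; exact hadj j hj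
      · rw [if_neg (by lia), if_neg (by lia)]
        rw [show m + 1 + (j - i) = m + (j - i) + 1 by lia]; exact hadj _ (by lia)
  · intro hijadj
    by_contra! hne
    have := hmin (k - (j - i - 1)) (fun m => if m ≤ i then f m else f (m + (j - i - 1))) ?_
    · lia
    refine ⟨by lia, by simp [h0], ?_, ?_, ?_⟩
    · beta_reduce
      rw [if_neg (by lia), ← hkk]; congr 1; lia
    · intro m h₀ h₁
      beta_reduce
      split_ifs
      · exact hA m h₀ (by lia)
      · exact hA _ (by lia) (by lia)
    · intro m hm
      beta_reduce
      rcases lt_trichotomy m i with hmi | rfl | hmi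
      · rw [if_pos (by lia), if_pos (by lia)]; exact hadj m (by lia)
      · rw [if_pos le_rfl, if_neg (by lia)]
        rw [show m + 1 + (j - m - 1) = j by lia]; exact hijadj
      · rw [if_neg (by lia), if_neg (by lia)]
        rw [show m + 1 + (j - i - 1) = m + (j - i - 1) + 1 by lia]; exact hadj _ (by lia)

lemma IsChordal.false_of_induced_cycle (hch : IsChordal G) {n : ℕ} (hn : 4 ≤ n) (f : ℕ → V)
    (hinj : ∀ i j, i < j → j < n → f i ≠ f j)
    (hadj : ∀ i j, i < j → j < n → (G.Adj (f i) (f j) ↔ j = i + 1 ∨ (i = 0 ∧ j = n - 1))) :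
    False := by
  have hlt : ∀ i j : Fin n, i < j →
      (G.Adj (f i) (f j) ↔ (cycleGraph n).Adj i j) := by
    intro i j hij
    rw [hadj i j hij j.2, cycleGraph_adj', Fin.sub_val_of_le hij.le, Fin.coe_sub_iff_lt.2 hij]
    lia
  refine (hch n hn).false ⟨⟨fun i => f i, ?_⟩, ?_⟩
  · intro i j hij
    by_contra hne
    rcases lt_or_gt_of_ne hne with h | h
    · exact hinj i j h j.2 hij
    · exact hinj j i h i.2 hij.symm
  · intro i j
    change G.Adj (f i) (f j) ↔ _
    rcases lt_trichotomy i j with h | rfl | h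
    · exact hlt i j h
    · simp
    · rw [G.adj_comm, (cycleGraph n).adj_comm]; exact hlt j i h

/-- Distinct vertices of a minimal vertex separator of a chordal graph are adjacent, and have a
common neighbour on either side. -/
lemma IsChordal.adj_and_exists_common_neighbors (hch : IsChordal G) (h : SeparatedBy G S u v)
    (hmin : ∀ T ⊂ S, ¬ SeparatedBy G T u v) (hx : x ∈ S) (hy : y ∈ S) (hxy : x ≠ y) :
    G.Adj x y ∧ (∃ a ∈ componentAvoiding G S u, G.Adj a x ∧ G.Adj a y) ∧
      ∃ b ∈ componentAvoiding G S v, G.Adj b x ∧ G.Adj b y := by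
  have path : ∀ u v, SeparatedBy G S u v → (∀ T ⊂ S, ¬ SeparatedBy G T u v) →
      ∃ k f, IsTraceThrough G (componentAvoiding G S u) x y k f ∧ ∀ i j, i < j → j ≤ k →
        f i ≠ f j ∧ (G.Adj (f i) (f j) → j = i + 1 ∨ (i = 0 ∧ j = k)) := by
    intro u v h hmin
    obtain ⟨a, ha, hxa⟩ := exists_adj_mem_componentAvoiding h hmin hx
    obtain ⟨b, hb, hyb⟩ := exists_adj_mem_componentAvoiding h hmin hy
    exact IsTraceThrough.exists_induced hxy (fun h => not_mem_of_mem_componentAvoiding h hx)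
      (fun h => not_mem_of_mem_componentAvoiding h hy) (exists_isTraceThrough ha hb hxa hyb)
  have hxyadj : G.Adj x y := by
    by_contra hnadj
    obtain ⟨k, f, ⟨hk, f0, fk, fA, fadj⟩, find⟩ := path u v h hmin
    obtain ⟨l, g, ⟨hl, g0, gl, gB, gadj⟩, gind⟩ :=
      path v u h.symm fun T hT h' => hmin T hT h'.symm
    have hne : ∀ i j, 0 < i → i < k → 0 < j → j < l → f i ≠ g j := by
      intro i j hi hik hj hjl heq
      exact Set.disjoint_left.1 h.disjoint_componentAvoiding (fA i hi hik) (heq ▸ gB j hj hjl)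
    have hna : ∀ i j, 0 < i → i < k → 0 < j → j < l → ¬ G.Adj (f i) (g j) := by
      intro i j hi hik hj hjl hadj
      exact Set.disjoint_left.1 h.disjoint_componentAvoiding
        (mem_componentAvoiding_of_adj (fA i hi hik) hadj
          (not_mem_of_mem_componentAvoiding (gB j hj hjl))) (gB j hj hjl)
    have fiff : ∀ i j, i < j → j ≤ k → (G.Adj (f i) (f j) ↔ j = i + 1) := by
      intro i j hij hjk
      refine ⟨fun hadj => ?_, ?_⟩
      · rcases (find i j hij hjk).2 hadj with h' | ⟨rfl, rfl⟩
        · exact h'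
        · exact absurd (f0 ▸ fk ▸ hadj) hnadj
      · rintro rfl; exact fadj i (by lia)
    have giff : ∀ i j, i < j → j ≤ l → (G.Adj (g i) (g j) ↔ j = i + 1) := by
      intro i j hij hjl
      refine ⟨fun hadj => ?_, ?_⟩
      · rcases (gind i j hij hjl).2 hadj with h' | ⟨rfl, rfl⟩
        · exact h'
        · exact absurd (g0 ▸ gl ▸ hadj) hnadj
      · rintro rfl; exact gadj i (by lia)
    refine hch.false_of_induced_cycle (n := k + l) (by lia)
      (fun i => if i ≤ k then f i else g (k + l - i)) ?_ ?_
    · intro i j hij hj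
      by_cases hjk : j ≤ k
      · simpa [hjk, show i ≤ k by lia] using (find i j hij hjk).1
      by_cases hik : i ≤ k
      · simp only [hik, hjk, if_true, if_false]
        rcases Nat.eq_zero_or_pos i with rfl | hi
        · rw [f0, ← g0]; exact (gind 0 _ (by lia) (by lia)).1
        rcases hik.eq_or_lt with rfl | hik
        · rw [fk, ← gl]; exact (gind _ l (by lia) le_rfl).1.symm
        · exact hne i _ hi hik (by lia) (by lia)
      · simp only [hik, hjk, if_false]
        exact (gind _ _ (by lia) (by lia)).1.symm
    · intro i j hij hj
      by_cases hjk : j ≤ k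
      · simp only [hjk, show i ≤ k by lia, if_true]
        rw [fiff i j hij hjk]; lia
      by_cases hik : i ≤ k
      · simp only [hik, hjk, if_true, if_false]
        rcases Nat.eq_zero_or_pos i with rfl | hi
        · rw [f0, ← g0, giff 0 _ (by lia) (by lia)]; lia
        rcases hik.eq_or_lt with rfl | hik
        · rw [fk, ← gl, G.adj_comm, giff _ l (by lia) le_rfl]; lia
        · have := hna i (k + l - j) hi hik (by lia) (by lia)
          simp only [this, false_iff]; lia
      · simp only [hik, hjk, if_false]
        rw [G.adj_comm, giff _ _ (by lia) (by lia)]; lia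
  have common : ∀ u v, SeparatedBy G S u v → (∀ T ⊂ S, ¬ SeparatedBy G T u v) →
      ∃ a ∈ componentAvoiding G S u, G.Adj a x ∧ G.Adj a y := by
    intro u v h hmin
    obtain ⟨k, f, ⟨hk, f0, fk, fA, fadj⟩, find⟩ := path u v h hmin
    rcases hk.eq_or_lt with rfl | hk
    · exact ⟨f 1, fA 1 (by lia) (by lia), f0 ▸ (fadj 0 (by lia)).symm, fk ▸ fadj 1 (by lia)⟩
    · refine (hch.false_of_induced_cycle (n := k + 1) (by lia) f
        (fun i j hij hj => (find i j hij (by lia)).1) fun i j hij hj =>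
          ⟨fun hadj => by simpa using (find i j hij (by lia)).2 hadj, ?_⟩).elim
      rintro (rfl | ⟨rfl, rfl⟩)
      · exact fadj i (by lia)
      · simpa [f0, fk] using hxyadj
  exact ⟨hxyadj, common u v h hmin, common v u h.symm fun T hT h' => hmin T hT h'.symm⟩

/-- If an mvs contains `x` but not `y`, some neighbour of `x` is neither `y` nor adjacent to `y`. -/
lemma IsMVS.exists_adj_not_adj (hS : IsMVS G S) (hx : x ∈ S) (hy : y ∉ S) :
    ∃ d, G.Adj x d ∧ ¬ G.Adj d y ∧ d ≠ y := by
  obtain ⟨u, v, -, -, h, hmin⟩ := hS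
  have key : ∀ u v, SeparatedBy G S u v → (∀ T ⊂ S, ¬ SeparatedBy G T u v) →
      y ∉ componentAvoiding G S u → ∃ d, G.Adj x d ∧ ¬ G.Adj d y ∧ d ≠ y := by
    intro u v h hmin hyu
    obtain ⟨d, hd, hxd⟩ := exists_adj_mem_componentAvoiding h hmin hx
    exact ⟨d, hxd, fun hdy => hyu (mem_componentAvoiding_of_adj hd hdy hy), fun e => hyu (e ▸ hd)⟩
  by_cases hyu : y ∈ componentAvoiding G S u
  · exact key v u h.symm (fun T hT h' => hmin T hT h'.symm)
      (Set.disjoint_left.1 h.disjoint_componentAvoiding hyu)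
  · exact key u v h hmin hyu

lemma nonempty_gem_embedding {p₀ p₁ p₂ p₃ c : V} (h₀₁ : G.Adj p₀ p₁) (h₁₂ : G.Adj p₁ p₂)
    (h₂₃ : G.Adj p₂ p₃) (h₀₂ : ¬ G.Adj p₀ p₂) (h₀₃ : ¬ G.Adj p₀ p₃) (h₁₃ : ¬ G.Adj p₁ p₃)
    (c₀ : G.Adj c p₀) (c₁ : G.Adj c p₁) (c₂ : G.Adj c p₂) (c₃ : G.Adj c p₃) :
    Nonempty (gem ↪g G) := by
  have n₀₂ : p₀ ≠ p₂ := by rintro rfl; exact h₀₃ h₂₃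
  have n₁₃ : p₁ ≠ p₃ := by rintro rfl; exact h₀₃ h₀₁
  have n₀₃ : p₀ ≠ p₃ := by rintro rfl; exact h₁₃ h₀₁.symm
  refine ⟨⟨⟨![p₀, p₁, p₂, p₃, c], ?_⟩, ?_⟩⟩
  · intro i j
    fin_cases i <;> fin_cases j <;> simp [*, h₀₁.ne, h₁₂.ne, h₂₃.ne, c₀.ne, c₁.ne, c₂.ne, c₃.ne,
      h₀₁.ne', h₁₂.ne', h₂₃.ne', c₀.ne', c₁.ne', c₂.ne', c₃.ne', n₀₂.symm, n₁₃.symm, n₀₃.symm]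
  · intro i j
    change G.Adj (![p₀, p₁, p₂, p₃, c] i) (![p₀, p₁, p₂, p₃, c] j) ↔ _
    fin_cases i <;> fin_cases j <;> simp [gem, *, G.adj_comm p₁ p₀, G.adj_comm p₂ p₁,
      G.adj_comm p₃ p₂, G.adj_comm p₂ p₀, G.adj_comm p₃ p₀, G.adj_comm p₃ p₁, G.adj_comm _ c]

lemma nonempty_dart_embedding {a x y b d : V} (hxy : G.Adj x y) (hax : G.Adj a x)
    (hay : G.Adj a y) (hbx : G.Adj b x) (hby : G.Adj b y) (hdx : G.Adj d x) (hab : ¬ G.Adj a b)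
    (nab : a ≠ b) (hdy : ¬ G.Adj d y) (hda : ¬ G.Adj d a) (hdb : ¬ G.Adj d b) (ndy : d ≠ y) :
    Nonempty (dart ↪g G) := by
  have nda : d ≠ a := by rintro rfl; exact hdy hay
  have ndb : d ≠ b := by rintro rfl; exact hdy hby
  refine ⟨⟨⟨![a, x, y, b, d], ?_⟩, ?_⟩⟩
  · intro i j
    fin_cases i <;> fin_cases j <;> simp [*, hxy.ne, hax.ne, hay.ne, hbx.ne, hby.ne, hdx.ne,
      hxy.ne', hax.ne', hay.ne', hbx.ne', hby.ne', hdx.ne', nab.symm, nda.symm, ndb.symm, ndy.symm]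
  · intro i j
    change G.Adj (![a, x, y, b, d] i) (![a, x, y, b, d] j) ↔ _
    fin_cases i <;> fin_cases j <;> simp [dart, *, hxy.symm, hax.symm, hay.symm, hbx.symm,
      hby.symm, hdx.symm, G.adj_comm b a, G.adj_comm y d, G.adj_comm a d, G.adj_comm b d]

lemma IsMVS.subset_of_not_disjoint (hch : IsChordal G) (hgem : IsEmpty (gem ↪g G))
    (hdart : IsEmpty (dart ↪g G)) (hS : IsMVS G S) (hT : IsMVS G T) (hST : ¬ Disjoint S T) :
    S ⊆ T := by
  obtain ⟨x, hxS, hxT⟩ := Set.not_disjoint_iff.1 hST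
  intro y hyS
  by_contra hyT
  obtain ⟨d, hxd, hdy, ndy⟩ := hT.exists_adj_not_adj hxT hyT
  obtain ⟨u, v, -, -, h, hmin⟩ := hS
  obtain ⟨hxy, ⟨a, ha, hax, hay⟩, b, hb, hbx, hby⟩ :=
    hch.adj_and_exists_common_neighbors h hmin hxS hyS (fun e => hyT (e ▸ hxT))
  have hdisj := Set.disjoint_left.1 h.disjoint_componentAvoiding
  have nab : a ≠ b := fun e => hdisj ha (e ▸ hb)
  have hab : ¬ G.Adj a b := fun hadj =>
    hdisj (mem_componentAvoiding_of_adj ha hadj (not_mem_of_mem_componentAvoiding hb)) hb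
  by_cases hda : G.Adj d a <;> by_cases hdb : G.Adj d b
  · have nda := hda.ne
    have ndb := hdb.ne
    have nay := hay.ne
    have nby := hby.ne
    refine hch.false_of_induced_cycle le_rfl
      (fun i => if i = 0 then d else if i = 1 then a else if i = 2 then y else b) ?_ ?_
    · intro i j hij hj
      interval_cases j <;> interval_cases i <;> simp [*, nby.symm]
    · intro i j hij hj
      interval_cases j <;> interval_cases i <;> simp [*, hby.symm]
  · exact hgem.false
      (nonempty_gem_embedding hda hay hby.symm hdy hdb hab hxd hax.symm hxy hbx.symm).some
  · exact hgem.false (nonempty_gem_embedding hdb hby hay.symm hdy hda (fun h' => hab h'.symm) hxd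
      hbx.symm hxy hax.symm).some
  · exact hdart.false
      (nonempty_dart_embedding hxy hax hay hbx hby hxd.symm hab nab hdy hda hdb ndy).some

lemma isEmpty_gem_embedding [Finite V]
    (hdisj : ∀ S S' : Set V, IsMVS G S → IsMVS G S' → S ≠ S' → Disjoint S S') :
    IsEmpty (gem ↪g G) := by
  refine ⟨fun e => ?_⟩
  have adj : ∀ {i j}, gem.Adj i j → G.Adj (e i) (e j) := e.map_rel_iff.2
  obtain ⟨S, hsep, hS⟩ := exists_minimal_separatedBy (G := G) (u := e 0) (v := e 2)
    (e.injective.ne (by simp)) (e.map_rel_iff.not.2 (by simp [gem]))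
  obtain ⟨T, hsep', hT⟩ := exists_minimal_separatedBy (G := G) (u := e 1) (v := e 3)
    (e.injective.ne (by simp)) (e.map_rel_iff.not.2 (by simp [gem]))
  have h₁ : e 1 ∈ S := hsep.mem_of_adj_of_adj (adj (by simp [gem])) (adj (by simp [gem]))
  have h₄ : e 4 ∈ S := hsep.mem_of_adj_of_adj (adj (by simp [gem])) (adj (by simp [gem]))
  have h₄' : e 4 ∈ T := hsep'.mem_of_adj_of_adj (adj (by simp [gem])) (adj (by simp [gem]))
  have hne : S ≠ T := by rintro rfl; exact hsep'.1 h₁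
  exact Set.disjoint_left.1 (hdisj S T hS hT hne) h₄ h₄'

lemma isEmpty_dart_embedding [Finite V]
    (hdisj : ∀ S S' : Set V, IsMVS G S → IsMVS G S' → S ≠ S' → Disjoint S S') :
    IsEmpty (dart ↪g G) := by
  refine ⟨fun e => ?_⟩
  have adj : ∀ {i j}, dart.Adj i j → G.Adj (e i) (e j) := e.map_rel_iff.2
  obtain ⟨S, hsep, hS⟩ := exists_minimal_separatedBy (G := G) (u := e 0) (v := e 3)
    (e.injective.ne (by simp)) (e.map_rel_iff.not.2 (by simp [dart]))
  obtain ⟨T, hsep', hT⟩ := exists_minimal_separatedBy (G := G) (u := e 2) (v := e 4)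
    (e.injective.ne (by simp)) (e.map_rel_iff.not.2 (by simp [dart]))
  have h₂ : e 2 ∈ S := hsep.mem_of_adj_of_adj (adj (by simp [dart])) (adj (by simp [dart]))
  have h₁ : e 1 ∈ S := hsep.mem_of_adj_of_adj (adj (by simp [dart])) (adj (by simp [dart]))
  have h₁' : e 1 ∈ T := hsep'.mem_of_adj_of_adj (adj (by simp [dart])) (adj (by simp [dart]))
  have hne : S ≠ T := by rintro rfl; exact hsep'.1 h₂
  exact Set.disjoint_left.1 (hdisj S T hS hT hne) h₁ h₁'

end Separators

theorem statement2 {V : Type*} [Finite V] (G : SimpleGraph V)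
    (hconn : G.Connected) (hch : IsChordal G) :
    (∀ S S' : Set V, IsMVS G S → IsMVS G S' → S ≠ S' → Disjoint S S') ↔
      (IsEmpty (gem ↪g G) ∧ IsEmpty (dart ↪g G)) := by
  refine ⟨fun h => ⟨isEmpty_gem_embedding h, isEmpty_dart_embedding h⟩, ?_⟩
  rintro ⟨hgem, hdart⟩ S T hS hT hne
  by_contra hST
  exact hne ((hS.subset_of_not_disjoint hch hgem hdart hT hST).antisymm
    (hT.subset_of_not_disjoint hch hgem hdart hS fun h => hST h.symm))
end

section
/- Let G be a non-complete strictly chordal graph. Then τ(G) = min over all minimal vertex separators S of G of |S| / ω(G−S), where ω(G−S) equals μ(S) + 1. -/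
open SimpleGraph

variable {V : Type*}

/-- `a` and `b` lie in a common connected component of `G - S`. -/
def ReachOff (G : SimpleGraph V) (S : Set V) (a b : V) : Prop :=
  ∃ (ha : a ∈ Sᶜ) (hb : b ∈ Sᶜ), (G.induce Sᶜ).Reachable ⟨a, ha⟩ ⟨b, hb⟩

namespace ReachOff

variable {G : SimpleGraph V} {S T : Set V} {a b c : V}

theorem left_notMem (h : ReachOff G S a b) : a ∉ S := h.1

theorem right_notMem (h : ReachOff G S a b) : b ∉ S := h.2.1

theorem refl (ha : a ∉ S) : ReachOff G S a a := ⟨ha, ha, Reachable.refl _⟩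

theorem symm (h : ReachOff G S a b) : ReachOff G S b a :=
  ⟨h.2.1, h.1, h.2.2.symm⟩

theorem trans (h : ReachOff G S a b) (h' : ReachOff G S b c) : ReachOff G S a c :=
  ⟨h.1, h'.2.1, h.2.2.trans h'.2.2⟩

theorem of_adj (ha : a ∉ S) (hb : b ∉ S) (h : G.Adj a b) : ReachOff G S a b :=
  ⟨ha, hb, Adj.reachable (by simpa using h)⟩

theorem induction {P : V → Prop} (h : ReachOff G S a b) (h0 : P a)
    (hs : ∀ x y, y ∉ S → G.Adj x y → P x → P y) : P b := by
  obtain ⟨ha, hb, ⟨w⟩⟩ := h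
  suffices H : ∀ x y : ↥Sᶜ, (G.induce Sᶜ).Walk x y → P x → P y from H _ _ w h0
  intro x y w
  induction w with
  | nil => exact id
  | @cons x y z hadj _ ih => exact fun hx => ih (hs _ _ y.2 hadj hx)

theorem mono (hST : S ⊆ T) (h : ReachOff G T a b) : ReachOff G S a b := by
  have haS : a ∉ S := fun h' => h.left_notMem (hST h')
  refine h.induction (refl haS) fun x y hy hxy hx => ?_
  exact hx.trans (of_adj hx.right_notMem (fun h' => hy (hST h')) hxy)

/-- Walking in `G - (S \ T)` from outside `S`, either one stays in the same component of `G - S`,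
or that component has a neighbour in `T`. -/
theorem or_exists_adj (h : ReachOff G (S \ T) a b) (ha : a ∉ S) :
    ReachOff G S a b ∨ ∃ a' t, ReachOff G S a a' ∧ t ∈ T ∧ G.Adj a' t := by
  refine h.induction (P := fun z => ReachOff G S a z ∨ _) (Or.inl (refl ha)) ?_
  rintro x y hy hxy (hx | hx)
  · by_cases hyT : y ∈ T
    · exact Or.inr ⟨x, y, hx, hyT, hxy⟩
    · exact Or.inl (hx.trans (of_adj hx.right_notMem (fun h' => hy ⟨h', hyT⟩) hxy))
  · exact Or.inr hx

/-- Two components of `G - S` that merge in `G - (S \ T)` both have neighbours in `T`. -/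
theorem exists_adj_adj (h : ReachOff G (S \ T) a b) (ha : a ∉ S) (hb : b ∉ S)
    (hab : ¬ ReachOff G S a b) :
    ∃ a' b' t₁ t₂, ReachOff G S a a' ∧ ReachOff G S b b' ∧ t₁ ∈ T ∧ t₂ ∈ T ∧
      G.Adj a' t₁ ∧ G.Adj b' t₂ := by
  obtain h₁ | ⟨a', t₁, h₁, ht₁, hadj₁⟩ := h.or_exists_adj ha
  · exact (hab h₁).elim
  obtain h₂ | ⟨b', t₂, h₂, ht₂, hadj₂⟩ := h.symm.or_exists_adj hb
  · exact (hab h₂.symm).elim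
  exact ⟨a', b', t₁, t₂, h₁, h₂, ht₁, ht₂, hadj₁, hadj₂⟩

end ReachOff

theorem separatedBy_iff {G : SimpleGraph V} {S : Set V} {a b : V} :
    SeparatedBy G S a b ↔ a ∉ S ∧ b ∉ S ∧ ¬ ReachOff G S a b :=
  ⟨fun ⟨ha, hb, h⟩ => ⟨ha, hb, fun ⟨_, _, h'⟩ => h h'⟩,
    fun ⟨ha, hb, h⟩ => ⟨ha, hb, fun h' => h ⟨ha, hb, h'⟩⟩⟩

theorem SeparatedBy.not_adj {G : SimpleGraph V} {S : Set V} {a b : V}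
    (h : SeparatedBy G S a b) : ¬ G.Adj a b := fun hab =>
  have h := separatedBy_iff.1 h
  h.2.2 (.of_adj h.1 h.2.1 hab)

theorem SeparatedBy.ne {G : SimpleGraph V} {S : Set V} {a b : V}
    (h : SeparatedBy G S a b) : a ≠ b := by
  rintro rfl
  have h := separatedBy_iff.1 h
  exact h.2.2 (.refl h.1)

/-- A separator meets every path of length at most three. -/
theorem SeparatedBy.mem_or_mem {G : SimpleGraph V} {S : Set V} {a b s t : V}
    (h : SeparatedBy G S a b) (has : G.Adj a s) (hst : s = t ∨ G.Adj s t) (hbt : G.Adj b t) :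
    s ∈ S ∨ t ∈ S := by
  by_contra! hc
  obtain ⟨ha, hb, h⟩ := separatedBy_iff.1 h
  have h₁ : ReachOff G S a s := .of_adj ha hc.1 has
  have h₂ : ReachOff G S b t := .of_adj hb hc.2 hbt
  obtain rfl | hst := hst
  · exact h (h₁.trans h₂.symm)
  · exact h ((h₁.trans (.of_adj hc.1 hc.2 hst)).trans h₂.symm)

theorem SeparatedBy.exists_isMVS [Finite V] {G : SimpleGraph V} {S : Set V} {a b : V}
    (h : SeparatedBy G S a b) : ∃ W ⊆ S, IsMVS G W ∧ SeparatedBy G W a b := by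
  obtain ⟨W, hWS, hW⟩ := exists_minimal_le_of_wellFoundedLT (fun W => SeparatedBy G W a b) S h
  exact ⟨W, hWS, ⟨a, b, h.ne, h.not_adj, hW.prop, fun T hT => hW.not_prop_of_lt hT⟩, hW.prop⟩

theorem separatedBy_neighborSet {G : SimpleGraph V} {a b : V} (hab : ¬ G.Adj a b) (hne : a ≠ b) :
    SeparatedBy G (G.neighborSet a) a b := by
  refine separatedBy_iff.2 ⟨by simp, by simpa using hab, fun h => hne ?_⟩
  refine h.induction (P := fun z => a = z) rfl ?_
  rintro x y hy hxy rfl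
  exact (hy hxy).elim

theorem IsMVS.exists_separatedBy_of_mem {G : SimpleGraph V} {T : Set V} (hT : IsMVS G T) {x : V}
    (hx : x ∈ T) : ∃ a b, G.Adj a x ∧ G.Adj b x ∧ SeparatedBy G T a b := by
  obtain ⟨u, v, -, -, huv, hmin⟩ := hT
  obtain ⟨hu, hv, hr⟩ := separatedBy_iff.1 huv
  have hlt : T \ {x} ⊂ T := ⟨Set.sdiff_subset, fun h => (h hx).2 rfl⟩
  have hR : ReachOff G (T \ {x}) u v := by
    by_contra hc
    exact hmin _ hlt (separatedBy_iff.2 ⟨fun h => hu h.1, fun h => hv h.1, hc⟩)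
  obtain ⟨a, b, _, _, ha, hb, rfl, rfl, hax, hbx⟩ := hR.exists_adj_adj hu hv hr
  exact ⟨a, b, hax, hbx, separatedBy_iff.2 ⟨ha.right_notMem, hb.right_notMem,
    fun h => hr ((ha.trans h).trans hb.symm)⟩⟩

theorem IsMVS.nonempty {G : SimpleGraph V} (hG : G.Connected) {T : Set V} (hT : IsMVS G T) :
    T.Nonempty := by
  obtain ⟨u, v, -, -, huv, -⟩ := hT
  obtain ⟨-, -, hr⟩ := separatedBy_iff.1 huv
  by_contra! hc
  subst hc
  obtain ⟨w⟩ := hG.preconnected u v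
  apply hr
  suffices H : ∀ x y, G.Walk x y → ReachOff G ∅ x y from H _ _ w
  intro x y w
  induction w with
  | nil => exact .refl (Set.notMem_empty _)
  | cons h _ ih => exact (ReachOff.of_adj (Set.notMem_empty _) (Set.notMem_empty _) h).trans ih

theorem IsChordal.adj_of_common_neighbors {G : SimpleGraph V} (hG : IsChordal G) {a b x y : V}
    (hab : ¬ G.Adj a b) (hne : a ≠ b) (hax : G.Adj a x) (hay : G.Adj a y) (hbx : G.Adj b x)
    (hby : G.Adj b y) (hxy : x ≠ y) : G.Adj x y := by
  by_contra hc
  have hinj : Function.Injective ![a, x, b, y] := by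
    intro i j
    fin_cases i <;> fin_cases j <;>
      simp [hne, hne.symm, hxy, hxy.symm, hax.ne, hay.ne, hbx.ne, hby.ne, hax.ne', hay.ne',
        hbx.ne', hby.ne']
  refine (hG 4 le_rfl).false ⟨⟨![a, x, b, y], hinj⟩, ?_⟩
  intro i j
  fin_cases i <;> fin_cases j <;>
    simp [cycleGraph_adj, hax, hay, hbx, hby, hax.symm, hay.symm, hbx.symm, hby.symm, hab, hc,
      G.adj_comm b a, G.adj_comm y x] <;> decide

theorem StrictlyChordal.eq_of_mem {G : SimpleGraph V} {S T : Set V} (hG : StrictlyChordal G)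
    (hS : IsMVS G S) (hT : IsMVS G T) {x : V} (hxS : x ∈ S) (hxT : x ∈ T) : S = T := by
  by_contra hne
  exact Set.disjoint_left.1 (hG.2.2 S T hS hT hne) hxS hxT

section StrictlyChordal

variable [Finite V] {G : SimpleGraph V} {S T : Set V}

theorem StrictlyChordal.isClique_of_isMVS (hG : StrictlyChordal G) (hT : IsMVS G T) :
    G.IsClique T := by
  intro x hx y hy hxy
  obtain ⟨a, b, hax, hbx, hab⟩ := hT.exists_separatedBy_of_mem hx
  have key : ∀ {c d}, ¬ G.Adj c d → c ≠ d → G.Adj c x → G.Adj d x → G.Adj c y := by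
    intro c d hcd hne hcx hdx
    obtain ⟨W, hWN, hW, hsep⟩ := (separatedBy_neighborSet hcd hne).exists_isMVS
    have hxW : x ∈ W := by simpa using hsep.mem_or_mem hcx (Or.inl rfl) hdx
    obtain rfl := hG.eq_of_mem hW hT hxW hx
    exact hWN hy
  have hba : ¬ G.Adj b a := fun h => hab.not_adj h.symm
  exact hG.2.1.adj_of_common_neighbors hab.not_adj hab.ne hax (key hab.not_adj hab.ne hax hbx) hbx
    (key hba hab.ne.symm hbx hax) hxy

theorem one_lt_numComp {a b : V} (h : SeparatedBy G S a b) : 1 < numComp G S := by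
  obtain ⟨ha, hb, h⟩ := h
  rw [numComp, Finite.one_lt_card_iff_nontrivial]
  exact ⟨connectedComponentMk _ ⟨a, ha⟩, connectedComponentMk _ ⟨b, hb⟩,
    fun h' => h (ConnectedComponent.exact h')⟩

theorem exists_separatedBy_of_one_lt_numComp (h : 1 < numComp G S) :
    ∃ a b, SeparatedBy G S a b := by
  rw [numComp, Finite.one_lt_card_iff_nontrivial] at h
  obtain ⟨C, D, hCD⟩ := h
  induction C using ConnectedComponent.ind with | _ a
  induction D using ConnectedComponent.ind with | _ b
  exact ⟨a, b, a.2, b.2, fun h' => hCD (ConnectedComponent.sound h')⟩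

theorem IsMVS.one_lt_numComp (hS : IsMVS G S) : 1 < numComp G S := by
  obtain ⟨u, v, -, -, h, -⟩ := hS
  exact _root_.one_lt_numComp h

/-- The map on components induced by the inclusion of `G - S` into `G - T`. -/
def componentMap (G : SimpleGraph V) {S T : Set V} (h : T ⊆ S) :
    (G.induce Sᶜ).ConnectedComponent → (G.induce Tᶜ).ConnectedComponent :=
  ConnectedComponent.map (G.induceHomOfLE (Set.compl_subset_compl.2 h)).toHom

theorem numComp_le_numComp_diff_singleton {v : V} (hv : v ∈ S)
    (hS : ∀ W ⊆ S, IsMVS G W → v ∉ W) : numComp G S ≤ numComp G (S \ {v}) := by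
  refine Nat.card_le_card_of_injective (componentMap G Set.sdiff_subset) ?_
  intro C D hCD
  induction C using ConnectedComponent.ind with | _ a
  induction D using ConnectedComponent.ind with | _ b
  have hR : ReachOff G (S \ {v}) a b := ⟨_, _, ConnectedComponent.exact hCD⟩
  by_contra hne
  have hnR : ¬ ReachOff G S a b := fun ⟨_, _, h⟩ => hne (ConnectedComponent.sound h)
  obtain ⟨a', b', _, _, ha, hb, rfl, rfl, hav, hbv⟩ := hR.exists_adj_adj a.2 b.2 hnR
  have hsep : SeparatedBy G S a' b' := separatedBy_iff.2
    ⟨ha.right_notMem, hb.right_notMem, fun h => hnR ((ha.trans h).trans hb.symm)⟩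
  obtain ⟨W, hWS, hW, hsepW⟩ := hsep.exists_isMVS
  exact hS W hWS hW (by simpa using hsepW.mem_or_mem hav (Or.inl rfl) hbv)

theorem card_add_one_le_of_fiber {α β γ : Type*} [Finite α] [Finite β] [Finite γ] (f : α → β)
    (g : α → γ) (z : β)
    (h : ∀ x y, f x = f y → x ≠ y → f x = z ∧ g x ≠ g y) :
    Nat.card α + 1 ≤ Nat.card β + Nat.card γ := by
  classical
  have := Fintype.ofFinite α
  have := Fintype.ofFinite β
  have := Fintype.ofFinite γ
  simp only [Nat.card_eq_fintype_card, ← Finset.card_univ]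
  have h₁ : (Finset.univ.filter fun x => f x = z).card ≤ (Finset.univ : Finset γ).card := by
    refine Finset.card_le_card_of_injOn g (by simp) ?_
    intro x hx y hy hxy
    simp only [Finset.coe_filter, Finset.mem_univ, true_and, Set.mem_ofPred_eq] at hx hy
    by_contra hne
    exact (h x y (hx.trans hy.symm) hne).2 hxy
  have h₂ : (Finset.univ.filter fun x => ¬ f x = z).card ≤
      ((Finset.univ : Finset β).erase z).card := by
    refine Finset.card_le_card_of_injOn f (fun x hx => by simpa using hx) ?_
    intro x hx y hy hxy
    simp only [Finset.coe_filter, Finset.mem_univ, true_and, Set.mem_ofPred_eq] at hx hy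
    by_contra hne
    exact hx (h x y hxy hne).1
  have h₃ := Finset.card_filter_add_card_filter_not (s := (Finset.univ : Finset α))
    (fun x => f x = z)
  have h₄ := Finset.card_erase_add_one (Finset.mem_univ z)
  omega

theorem StrictlyChordal.numComp_add_one_le (hG : StrictlyChordal G) (hT : IsMVS G T)
    (hTS : T ⊆ S) : numComp G S + 1 ≤ numComp G (S \ T) + numComp G T := by
  obtain ⟨x, hx⟩ := hT.nonempty hG.1
  have hxS : x ∈ (S \ T)ᶜ := fun h => h.2 hx
  have hadj : ∀ t ∈ T, ∀ t' ∈ T, t = t' ∨ G.Adj t t' := fun t ht t' ht' =>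
    or_iff_not_imp_left.2 fun hne => hG.isClique_of_isMVS hT ht ht' hne
  refine card_add_one_le_of_fiber (componentMap G Set.sdiff_subset) (componentMap G hTS)
    (connectedComponentMk _ ⟨x, hxS⟩) ?_
  intro C D hCD hne
  induction C using ConnectedComponent.ind with | _ a
  induction D using ConnectedComponent.ind with | _ b
  have hR : ReachOff G (S \ T) a b := ⟨_, _, ConnectedComponent.exact hCD⟩
  have hnR : ¬ ReachOff G S a b := fun ⟨_, _, h⟩ => hne (ConnectedComponent.sound h)
  obtain ⟨a', b', t₁, t₂, ha, hb, ht₁, ht₂, hat, hbt⟩ := hR.exists_adj_adj a.2 b.2 hnR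
  constructor
  · have h₁ : ReachOff G (S \ T) a t₁ :=
      (ha.mono Set.sdiff_subset).trans
        (.of_adj (fun h => ha.right_notMem h.1) (fun h => h.2 ht₁) hat)
    have h₂ : ReachOff G (S \ T) a x := by
      obtain rfl | h := hadj t₁ ht₁ x hx
      · exact h₁
      · exact h₁.trans (.of_adj (fun h => h.2 ht₁) hxS h)
    exact ConnectedComponent.sound h₂.2.2
  · intro hg
    have hRT : ReachOff G T a b := ⟨_, _, ConnectedComponent.exact hg⟩
    have hsep : SeparatedBy G S a' b' := separatedBy_iff.2
      ⟨ha.right_notMem, hb.right_notMem, fun h => hnR ((ha.trans h).trans hb.symm)⟩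
    obtain ⟨W, hWS, hW, hsepW⟩ := hsep.exists_isMVS
    have hWT : W = T := by
      obtain h | h := hsepW.mem_or_mem hat (hadj t₁ ht₁ t₂ ht₂) hbt
      · exact hG.eq_of_mem hW hT h ht₁
      · exact hG.eq_of_mem hW hT h ht₂
    subst hWT
    exact (separatedBy_iff.1 hsepW).2.2 (((ha.mono hTS).symm.trans hRT).trans (hb.mono hTS))

/-- The minimal vertex separators contained in `S`. -/
noncomputable def mvsIn (G : SimpleGraph V) (S : Set V) : Finset (Set V) :=
  (Set.toFinite {W | IsMVS G W ∧ W ⊆ S}).toFinset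

theorem mem_mvsIn {W : Set V} : W ∈ mvsIn G S ↔ IsMVS G W ∧ W ⊆ S := by
  simp [mvsIn]

theorem mvsIn_mono (h : T ⊆ S) : mvsIn G T ⊆ mvsIn G S := fun W hW => by
  rw [mem_mvsIn] at hW ⊢
  exact ⟨hW.1, hW.2.trans h⟩

theorem StrictlyChordal.numComp_le (hG : StrictlyChordal G) (S : Set V) :
    numComp G S ≤ 1 + ∑ T ∈ mvsIn G S, (numComp G T - 1) := by
  classical
  induction S using WellFoundedLT.induction with | ind S ih
  by_cases hS : ∃ T ⊆ S, IsMVS G T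
  · obtain ⟨T, hTS, hT⟩ := hS
    obtain ⟨x, hx⟩ := hT.nonempty hG.1
    have h₁ := ih (S \ T) ⟨Set.sdiff_subset, fun h => (h (hTS hx)).2 hx⟩
    have h₂ := hG.numComp_add_one_le hT hTS
    have h₃ := hT.one_lt_numComp
    have hT' : T ∉ mvsIn G (S \ T) := fun h => ((mem_mvsIn.1 h).2 hx).2 hx
    have hsub : insert T (mvsIn G (S \ T)) ⊆ mvsIn G S :=
      Finset.insert_subset (mem_mvsIn.2 ⟨hT, hTS⟩) (mvsIn_mono Set.sdiff_subset)
    have h₄ := Finset.sum_le_sum_of_subset (f := fun T => numComp G T - 1) hsub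
    rw [Finset.sum_insert hT'] at h₄
    omega
  · obtain rfl | ⟨v, hv⟩ := S.eq_empty_or_nonempty
    · by_contra! hc
      obtain ⟨a, b, hab⟩ := exists_separatedBy_of_one_lt_numComp
        ((Nat.le_add_right _ _).trans_lt hc)
      obtain ⟨W, hW, hW', -⟩ := hab.exists_isMVS
      exact hS ⟨W, hW, hW'⟩
    · calc numComp G S ≤ numComp G (S \ {v}) :=
            numComp_le_numComp_diff_singleton hv fun W hW hW' => (hS ⟨W, hW, hW'⟩).elim
        _ ≤ _ := ih _ ⟨Set.sdiff_subset, fun h => (h hv).2 rfl⟩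
        _ ≤ _ := by gcongr; exact mvsIn_mono Set.sdiff_subset

theorem StrictlyChordal.sum_ncard_mvsIn_le (hG : StrictlyChordal G) (S : Set V) :
    ∑ T ∈ mvsIn G S, Nat.card T ≤ Nat.card S := by
  classical
  have := Fintype.ofFinite V
  have hcard : ∀ T : Set V, Nat.card T = T.toFinset.card := fun T => by
    rw [Nat.card_eq_fintype_card, Set.toFinset_card]
  simp only [hcard]
  rw [← Finset.card_biUnion]
  · refine Finset.card_le_card (Finset.biUnion_subset.2 fun T hT => ?_)
    exact Set.toFinset_subset_toFinset.2 (mem_mvsIn.1 hT).2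
  · intro T hT T' hT' hne
    exact Set.disjoint_toFinset.2 (hG.2.2 T T' (mem_mvsIn.1 hT).1 (mem_mvsIn.1 hT').1 hne)

theorem StrictlyChordal.mul_numComp_le (hG : StrictlyChordal G) {r : ℝ} (hr : 0 ≤ r)
    (h : ∀ T, IsMVS G T → r * numComp G T ≤ Nat.card T) (hS : 1 < numComp G S) :
    r * numComp G S ≤ Nat.card S := by
  have h₁ := hG.numComp_le S
  have hne : (mvsIn G S).Nonempty := by
    by_contra! hc
    rw [hc, Finset.sum_empty] at h₁
    omega
  have h₂ : numComp G S ≤ ∑ T ∈ mvsIn G S, numComp G T := by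
    have h₃ : ∑ T ∈ mvsIn G S, numComp G T
        = ∑ T ∈ mvsIn G S, (numComp G T - 1) + (mvsIn G S).card := by
      rw [Finset.card_eq_sum_ones, ← Finset.sum_add_distrib]
      refine Finset.sum_congr rfl fun T hT => ?_
      have := (mem_mvsIn.1 hT).1.one_lt_numComp
      omega
    have := hne.card_pos
    omega
  calc r * numComp G S ≤ r * (∑ T ∈ mvsIn G S, numComp G T : ℕ) := by gcongr
    _ = ∑ T ∈ mvsIn G S, r * numComp G T := by push_cast; rw [Finset.mul_sum]
    _ ≤ ∑ T ∈ mvsIn G S, (Nat.card T : ℝ) :=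
        Finset.sum_le_sum fun T hT => h T (mem_mvsIn.1 hT).1
    _ ≤ Nat.card S := by exact_mod_cast hG.sum_ncard_mvsIn_le S

theorem exists_isMVS_of_ne_top (hG : G ≠ ⊤) : ∃ S, IsMVS G S := by
  obtain ⟨a, b, hne, hab⟩ := G.ne_top_iff_exists_not_adj.1 hG
  obtain ⟨W, -, hW, -⟩ := (separatedBy_neighborSet hab hne).exists_isMVS
  exact ⟨W, hW⟩

end StrictlyChordal

theorem statement4 {V : Type*} [Finite V] (G : SimpleGraph V)
    (hsc : StrictlyChordal G) (hnc : G ≠ ⊤) :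
    IsLeast {t : ℝ | ∃ S : Set V, IsMVS G S ∧
        t = (Nat.card S : ℝ) / (numComp G S : ℝ)} (toughness G) ∧
    ∀ S : Set V, IsMVS G S → numComp G S = (numComp G S - 1) + 1 := by
  refine ⟨?_, fun S hS => (Nat.sub_add_cancel hS.one_lt_numComp.le).symm⟩
  obtain ⟨S₀, hS₀, hmin⟩ := Set.exists_min_image {S | IsMVS G S}
    (fun S => (Nat.card S : ℝ) / (numComp G S : ℝ)) (Set.toFinite _) (exists_isMVS_of_ne_top hnc)
  have hpos : ∀ {S : Set V}, 1 < numComp G S → (0 : ℝ) < numComp G S := fun h => by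
    exact_mod_cast zero_lt_one.trans h
  have hleast : IsLeast
      {t : ℝ | ∃ S : Set V, 1 < numComp G S ∧ t = (Nat.card S : ℝ) / (numComp G S : ℝ)}
      ((Nat.card S₀ : ℝ) / (numComp G S₀ : ℝ)) := by
    refine ⟨⟨S₀, IsMVS.one_lt_numComp hS₀, rfl⟩, ?_⟩
    rintro _ ⟨S, hS, rfl⟩
    rw [le_div_iff₀ (hpos hS)]
    refine hsc.mul_numComp_le (by positivity) (fun T hT => ?_) hS
    rw [← le_div_iff₀ (hpos hT.one_lt_numComp)]
    exact hmin T hT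
  rw [toughness, hleast.csInf_eq]
  refine ⟨⟨S₀, hS₀, rfl⟩, ?_⟩
  rintro _ ⟨S, hS, rfl⟩
  exact hmin S hS
end

section
/- Let G be a strictly chordal graph. Then every minimal vertex separator of G is a minimal separator of G. -/
open SimpleGraph

variable {V : Type*}

theorem not_separatedBy_empty {V : Type*} {G : SimpleGraph V} {u v : V}
    (h : G.Reachable u v) : ¬ SeparatedBy G ∅ u v := by
  rintro ⟨hu, hv, hn⟩
  refine hn (h.map (G' := G.induce (∅ : Set V)ᶜ) ⟨fun x => ⟨x, Set.notMem_empty x⟩, ?_⟩)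
  exact fun hab => hab

/-- In a finite graph, every set separating two vertices contains a minimal vertex separator
of these vertices. -/
theorem SeparatedBy.exists_subset_isMVS {V : Type*} [Finite V] {G : SimpleGraph V} {T : Set V}
    {u v : V} (h : SeparatedBy G T u v) : ∃ S ⊆ T, SeparatedBy G S u v ∧ IsMVS G S := by
  obtain ⟨S, hST, hS⟩ := (Set.toFinite {R | SeparatedBy G R u v}).exists_le_minimal h
  refine ⟨S, hST, hS.prop, u, v, ?_, ?_, hS.prop, fun R hR => hS.not_prop_of_lt hR⟩
  · rintro rfl
    obtain ⟨_, _, hn⟩ := h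
    exact hn (Reachable.refl _)
  · intro hadj
    obtain ⟨hu, hv, hn⟩ := h
    exact hn (Adj.reachable (induce_adj.mpr hadj))

theorem statement5 {V : Type*} [Finite V] (G : SimpleGraph V)
    (hsc : StrictlyChordal G) (S : Set V) (hS : IsMVS G S) :
    IsMinimalSeparator G S := by
  obtain ⟨hconn, -, hdisj⟩ := hsc
  refine ⟨?_, ?_⟩
  · obtain ⟨u, v, -, -, hsep, -⟩ := hS
    exact ⟨u, v, hconn.preconnected u v, hsep⟩
  · rintro T hT ⟨u, v, hreach, hsep⟩
    obtain ⟨R, hRT, hR, hmvs⟩ := hsep.exists_subset_isMVS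
    have hRS : R ⊂ S := hRT.trans_ssubset hT
    obtain rfl : R = ∅ :=
      (hdisj R S hmvs hS hRS.ne).eq_bot_of_le hRS.subset
    exact not_separatedBy_empty hreach hR
end

section
/- Let G be a strictly chordal graph. Then every boundary clique of G contains exactly one minimal vertex separator of G (i.e., exactly one minimal vertex separator of G is a subset of the boundary clique). -/
open SimpleGraph

variable {V : Type*}

theorem separatedBy_iff_exists_closed {V : Type*} {G : SimpleGraph V} {S : Set V} {u v : V} :
    SeparatedBy G S u v ↔ ∃ C : Set V, u ∈ C ∧ v ∉ C ∧ v ∉ S ∧ Disjoint C S ∧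
      ∀ a ∈ C, ∀ b, b ∉ S → G.Adj a b → b ∈ C := by
  constructor
  · rintro ⟨hu, hv, h⟩
    refine ⟨{a | ∃ ha : a ∈ Sᶜ, (G.induce Sᶜ).Reachable ⟨u, hu⟩ ⟨a, ha⟩}, ⟨hu, .refl _⟩,
      fun ⟨_, h'⟩ => h h', hv, Set.disjoint_left.2 fun a ⟨ha, _⟩ => ha, ?_⟩
    rintro a ⟨ha, hr⟩ b hb hab
    exact ⟨hb, hr.trans (Adj.reachable (by simpa using hab))⟩
  · rintro ⟨C, hu, hv, hvS, hCS, hC⟩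
    refine ⟨Set.disjoint_left.1 hCS hu, hvS, fun ⟨p⟩ => ?_⟩
    have walk_mem : ∀ {a b : (Sᶜ : Set V)}, (G.induce Sᶜ).Walk a b → (a : V) ∈ C →
        (b : V) ∈ C := by
      intro a b p
      induction p with
      | nil => exact id
      | @cons a b c hab _ ih => exact fun ha => ih (hC a ha b b.2 (by simpa using hab))
    exact hv (walk_mem p hu)

theorem IsMVS.not_isSimplicial {V : Type*} {G : SimpleGraph V} {S : Set V} (hS : IsMVS G S)
    {x : V} (hx : x ∈ S) : ¬ IsSimplicial G x := by
  intro hsimp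
  obtain ⟨u, v, -, -, hsep, hmin⟩ := hS
  obtain ⟨C, hu, hv, hvS, hCS, hC⟩ := separatedBy_iff_exists_closed.1 hsep
  have hT := hmin (S \ {x}) (Set.sdiff_singleton_ssubset.2 hx)
  rw [separatedBy_iff_exists_closed] at hT
  have hvx : v ≠ x := fun h => hvS (h ▸ hx)
  obtain ⟨a, haC, hxa⟩ : ∃ a ∈ C, G.Adj x a := by
    by_contra! h
    refine hT ⟨C, hu, hv, fun h' => hvS h'.1, hCS.mono_right Set.sdiff_subset, ?_⟩
    intro a ha b hb hab
    by_cases hbx : b = x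
    · exact absurd (hbx ▸ hab).symm (h a ha)
    · exact hC a ha b (fun h' => hb ⟨h', hbx⟩) hab
  obtain ⟨b, hbC, hbS, hxb⟩ : ∃ b, b ∉ C ∧ b ∉ S ∧ G.Adj x b := by
    by_contra! h
    refine hT ⟨insert x C, Or.inr hu, ?_, fun h' => hvS h'.1, ?_, ?_⟩
    · rintro (h' | h')
      exacts [hvx h', hv h']
    · rw [Set.disjoint_left]
      rintro a (rfl | ha) haT
      exacts [haT.2 rfl, Set.disjoint_left.1 hCS ha haT.1]
    · intro a ha b hb hab
      by_cases hbx : b = x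
      · exact Or.inl hbx
      have hbS : b ∉ S := fun h' => hb ⟨h', hbx⟩
      rcases ha with rfl | ha
      · by_contra hbC
        exact h b (fun h' => hbC (Or.inr h')) hbS hab
      · exact Or.inr (hC a ha b hbS hab)
  exact hbC (hC a haC b hbS (hsimp hxa hxb fun h => hbC (h ▸ haC)))

theorem IsMVS.nonempty_s6 {V : Type*} {G : SimpleGraph V} (hG : G.Preconnected) {S : Set V}
    (hS : IsMVS G S) : S.Nonempty := by
  rw [Set.nonempty_iff_ne_empty]
  rintro rfl
  obtain ⟨u, v, -, -, hsep, -⟩ := hS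
  obtain ⟨C, hu, hv, -, -, hC⟩ := separatedBy_iff_exists_closed.1 hsep
  have walk_mem : ∀ {a b : V}, G.Walk a b → a ∈ C → b ∈ C := by
    intro a b p
    induction p with
    | nil => exact id
    | cons hab _ ih => exact fun ha => ih (hC _ ha _ (Set.notMem_empty _) hab)
  obtain ⟨p⟩ := hG u v
  exact hv (walk_mem p hu)

theorem IsMaxClique.mem_of_adj_of_isSimplicial {V : Type*} {G : SimpleGraph V} {Q : Set V}
    (hQ : IsMaxClique G Q) {x y : V} (hx : x ∈ Q) (hsimp : IsSimplicial G x) (hxy : G.Adj x y) :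
    y ∈ Q := by
  rw [hQ.2 (insert y Q) ?_ (Set.subset_insert _ _)]
  · exact Set.mem_insert _ _
  · refine hQ.1.insert fun z hz hyz => ?_
    by_cases hzx : z = x
    · exact hzx ▸ hxy.symm
    · exact hsimp hxy (hQ.1 hx hz (Ne.symm hzx)) hyz

theorem IsBoundaryClique.isMVS_nonsimplicial {V : Type*} {G : SimpleGraph V} {Q : Set V}
    (hQ : IsBoundaryClique G Q) : IsMVS G {v | v ∈ Q ∧ ¬ IsSimplicial G v} := by
  obtain ⟨hmax, ⟨v, hvQ, hv⟩, Q', hmax', hne, hinter⟩ := hQ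
  obtain ⟨w, hwQ', hwQ⟩ : ∃ w ∈ Q', w ∉ Q := by
    by_contra! h
    exact hne (hmax'.2 Q hmax.1 h)
  refine ⟨v, w, fun h => hwQ (h ▸ hvQ),
    fun h => hwQ (hmax.mem_of_adj_of_isSimplicial hvQ hv h), ?_, ?_⟩
  · refine separatedBy_iff_exists_closed.2 ⟨{x | x ∈ Q ∧ IsSimplicial G x}, ⟨hvQ, hv⟩,
      fun h => hwQ h.1, fun h => hwQ h.1, Set.disjoint_left.2 fun a ha hb => hb.2 ha.2, ?_⟩
    intro a ha b hb hab
    have hbQ := hmax.mem_of_adj_of_isSimplicial ha.1 ha.2 hab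
    exact ⟨hbQ, by_contra fun h => hb ⟨hbQ, h⟩⟩
  · intro T hT hsep
    obtain ⟨b, hb, hbT⟩ := Set.exists_of_ssubset hT
    obtain ⟨C, hvC, hwC, hwT, -, hC⟩ := separatedBy_iff_exists_closed.1 hsep
    have hbQ' : b ∈ Q' := (hinter.symm ▸ hb : b ∈ Q ∩ Q').2
    have hbC := hC v hvC b hbT (hmax.1 hvQ hb.1 fun h => hb.2 (h ▸ hv))
    exact hwC (hC b hbC w hwT (hmax'.1 hbQ' hwQ' fun h => hwQ (h ▸ hb.1)))

theorem statement6 {V : Type*} [Finite V] (G : SimpleGraph V)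
    (hsc : StrictlyChordal G) (Q : Set V) (hQ : IsBoundaryClique G Q) :
    ∃! S : Set V, IsMVS G S ∧ S ⊆ Q := by
  have hB := hQ.isMVS_nonsimplicial
  refine ⟨_, ⟨hB, fun _ h => h.1⟩, ?_⟩
  rintro S ⟨hS, hSQ⟩
  by_contra hne
  obtain ⟨x, hx⟩ := hS.nonempty_s6 hsc.1.preconnected
  exact Set.disjoint_left.1 (hsc.2.2 _ _ hS hB hne) hx ⟨hSQ hx, hS.not_isSimplicial hx⟩
end
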